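/- For every 0 < ρ < 1 and every ε > 0 there exists a linear map T : ℓ₁ → H^∞(B_{c₀}) such that ‖β‖_{ℓ₁} ≤ sup_{x ∈ B_{c₀}} |T(β)(x)| ≤ (1+ε)‖β‖_{ℓ₁} for every β ∈ ℓ₁, and for every β ∈ ℓ₁ with β ≠ 0 and every u ∈ ℓ_∞ with ‖u‖_∞ ≤ ρ, the cluster set Cl_{B_{c₀}}(T(β), u) contains an open disk of positive radius in ℂ. (Thus the set E_{ρ B̄_{ℓ_∞}}(B_{c₀}) ∪ {0} contains an almost isometric copy of ℓ₁.) -/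

import Mathlib

open Filter Topology Metric
open scoped ZeroAtInfty

noncomputable section

def clusterSetC0 (f : C₀(ℕ, ℂ) → ℂ) (u : ℕ → ℂ) : Set ℂ :=
  {lam | ∃ (ι : Type) (l : Filter ι) (x : ι → C₀(ℕ, ℂ)), l.NeBot ∧
    (∀ i, x i ∈ ball (0 : C₀(ℕ, ℂ)) 1) ∧
    (∀ a : lp (fun _ : ℕ => ℂ) 1,
      Tendsto (fun i => ∑' j, a j * x i j) l (nhds (∑' j, a j * u j))) ∧
    Tendsto (fun i => f (x i)) l (nhds lam)}

open BoundedContinuousFunction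

/-- The Cayley transform, an involution exchanging the unit disk and the right half-plane. -/
def cayley (z : ℂ) : ℂ := (1 - z) / (1 + z)

lemma cayley_zero : cayley 0 = 1 := by simp [cayley]

lemma one_add_ne_zero_of_norm_lt_one {z : ℂ} (hz : ‖z‖ < 1) : 1 + z ≠ 0 := by
  intro h
  have : z = -1 := by linear_combination h
  simp [this] at hz

lemma cayley_re_nonneg {z : ℂ} (hz : ‖z‖ < 1) : 0 ≤ (cayley z).re := by
  have h1 : z.re * z.re + z.im * z.im ≤ 1 := by
    rw [← Complex.normSq_apply, Complex.normSq_eq_norm_sq]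
    nlinarith [norm_nonneg z]
  have h2 := Complex.normSq_nonneg (1 + z)
  rw [cayley, Complex.div_re, ← add_div]
  apply div_nonneg _ h2
  simp only [Complex.sub_re, Complex.one_re, Complex.add_re, Complex.sub_im, Complex.one_im,
    Complex.add_im]
  nlinarith

lemma norm_cayley_le {z : ℂ} {r : ℝ} (hr : r < 1) (hz : ‖z‖ ≤ r) : ‖cayley z‖ ≤ 2 / (1 - r) := by
  have h1 : ‖1 - z‖ ≤ 2 := (norm_sub_le _ _).trans (by rw [norm_one]; linarith)
  have h2 : 1 - r ≤ ‖1 + z‖ := by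
    have := norm_sub_norm_le (1 : ℂ) (-z)
    rw [norm_neg, norm_one, sub_neg_eq_add] at this
    linarith
  rw [cayley, norm_div]
  exact div_le_div₀ (by norm_num) h1 (by linarith) h2

lemma one_add_ne_zero_of_re_pos {w : ℂ} (hw : 0 < w.re) : 1 + w ≠ 0 := by
  intro h
  have := congrArg Complex.re h
  simp at this
  linarith

lemma norm_cayley_lt_one {w : ℂ} (hw : 0 < w.re) : ‖cayley w‖ < 1 := by
  have h0 := one_add_ne_zero_of_re_pos hw
  rw [cayley, norm_div, div_lt_one (norm_pos_iff.2 h0)]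
  apply lt_of_pow_lt_pow_left₀ 2 (norm_nonneg _)
  rw [← Complex.normSq_eq_norm_sq, ← Complex.normSq_eq_norm_sq, Complex.normSq_apply,
    Complex.normSq_apply]
  simp only [Complex.sub_re, Complex.one_re, Complex.add_re, Complex.sub_im, Complex.one_im,
    Complex.add_im]
  nlinarith

lemma cayley_cayley {w : ℂ} (hw : 0 < w.re) : cayley (cayley w) = w := by
  have h0 := one_add_ne_zero_of_re_pos hw
  have h1 : (1 : ℂ) + (1 - w) / (1 + w) ≠ 0 := by
    rw [show (1 : ℂ) + (1 - w) / (1 + w) = 2 / (1 + w) by field_simp; ring]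
    exact div_ne_zero two_ne_zero h0
  rw [cayley, cayley, div_eq_iff h1]
  field_simp
  ring

/-- Summation against an absolutely summable sequence along rows, as an operator on `ℓ_∞`. -/
lemma exists_rowSum_clm {c : ℕ → ℂ} (hc : Summable fun i => ‖c i‖) (σ : ℕ → ℕ → ℕ) :
    ∃ R : (ℕ →ᵇ ℂ) →L[ℂ] (ℕ →ᵇ ℂ), ∀ y k, R y k = ∑' i, c i * y (σ k i) := by
  have hbd : ∀ (y : ℕ →ᵇ ℂ) k i, ‖c i * y (σ k i)‖ ≤ ‖c i‖ * ‖y‖ := fun y k i => by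
    rw [norm_mul]
    exact mul_le_mul_of_nonneg_left (y.norm_coe_le_norm _) (norm_nonneg _)
  have hs : ∀ (y : ℕ →ᵇ ℂ) k, Summable fun i => c i * y (σ k i) := fun y k =>
    Summable.of_norm_bounded (hc.mul_right ‖y‖) (hbd y k)
  have hle : ∀ (y : ℕ →ᵇ ℂ) k, ‖∑' i, c i * y (σ k i)‖ ≤ (∑' i, ‖c i‖) * ‖y‖ := fun y k => by
    rw [← tsum_mul_right]
    exact tsum_of_norm_bounded (hc.mul_right ‖y‖).hasSum (hbd y k)
  refine ⟨LinearMap.mkContinuous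
    { toFun := fun y => ofNormedAddCommGroupDiscrete (fun k => ∑' i, c i * y (σ k i)) _ (hle y)
      map_add' := fun y y' => ?_
      map_smul' := fun a y => ?_ } (∑' i, ‖c i‖) fun y => ?_, fun y k => rfl⟩
  · ext k
    change ∑' i, c i * (y + y') (σ k i) = ∑' i, c i * y (σ k i) + ∑' i, c i * y' (σ k i)
    rw [← (hs y k).tsum_add (hs y' k)]
    exact tsum_congr fun i => by simp [mul_add]
  · ext k
    change ∑' i, c i * (a • y) (σ k i) = a * ∑' i, c i * y (σ k i)
    rw [← tsum_mul_left]
    exact tsum_congr fun i => by simp [mul_left_comm]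
  · exact (norm_le (by positivity)).2 (hle y)

/-- The exponent of the singular inner function attached to the `k`-th row of coordinates. -/
def rowExponent (c : ℕ → ℂ) (k : ℕ) (y : ℕ → ℂ) : ℂ := ∑' i, c i * cayley (y (Nat.pair k i))

lemma summable_mul_cayley {c : ℕ → ℂ} (hc : Summable fun i => ‖c i‖) {y : ℕ → ℂ} {r : ℝ}
    (hr : r < 1) (hy : ∀ j, ‖y j‖ ≤ r) (k : ℕ) :
    Summable fun i => c i * cayley (y (Nat.pair k i)) :=
  Summable.of_norm_bounded (hc.mul_right (2 / (1 - r))) fun i => by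
    rw [norm_mul]
    exact mul_le_mul_of_nonneg_left (norm_cayley_le hr (hy _)) (norm_nonneg _)

lemma C0_norm_apply_le (x : C₀(ℕ, ℂ)) (j : ℕ) : ‖x j‖ ≤ ‖x‖ := x.toBCF.norm_coe_le_norm j

lemma differentiableOn_tsum_mul_exp {β c : ℕ → ℂ} (hβ : Summable fun i => ‖β i‖)
    (hc : Summable fun i => ‖c i‖) (d : ℂ) :
    DifferentiableOn ℂ (fun x : C₀(ℕ, ℂ) => ∑' k, β k * Complex.exp (d - rowExponent c k x))
      (ball 0 1) := by
  obtain ⟨R, hR⟩ := exists_rowSum_clm hc Nat.pair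
  obtain ⟨B, hB⟩ := exists_rowSum_clm hβ fun _ i => i
  let J : C₀(ℕ, ℂ) →L[ℂ] (ℕ →ᵇ ℂ) := LinearMap.mkContinuous
    { toFun := fun x => x.toBCF, map_add' := fun _ _ => rfl, map_smul' := fun _ _ => rfl } 1
    fun x => by rw [one_mul]; exact le_rfl
  let ev : ℕ → (ℕ →ᵇ ℂ) →+* ℂ := fun k =>
    { toFun := fun y => y k, map_one' := rfl, map_mul' := fun _ _ => rfl, map_zero' := rfl,
      map_add' := fun _ _ => rfl }
  have hunit : ∀ x ∈ ball (0 : C₀(ℕ, ℂ)) 1, IsUnit (1 + J x) := fun x hx => by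
    rw [← sub_neg_eq_add]
    apply isUnit_one_sub_of_norm_lt_one
    rw [norm_neg]
    exact mem_ball_zero_iff.1 hx
  have hcay : ∀ x ∈ ball (0 : C₀(ℕ, ℂ)) 1, ∀ j,
      ((1 - J x) * Ring.inverse (1 + J x)) j = cayley (x j) := fun x hx j => by
    have h := congrArg (fun y : ℕ →ᵇ ℂ => y j) (Ring.mul_inverse_cancel _ (hunit x hx))
    change (1 + x j) * Ring.inverse (1 + J x) j = 1 at h
    change (1 - x j) * Ring.inverse (1 + J x) j = (1 - x j) / (1 + x j)
    rw [eq_div_iff (left_ne_zero_of_mul_eq_one h)]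
    linear_combination (1 - x j) * h
  have hexp : Differentiable ℂ (NormedSpace.exp : (ℕ →ᵇ ℂ) → (ℕ →ᵇ ℂ)) := fun y =>
    (NormedSpace.exp_analytic (𝕂 := ℂ) y).differentiableAt
  have hev : ∀ k y, (NormedSpace.exp y : ℕ →ᵇ ℂ) k = Complex.exp (y k) := fun k y => by
    rw [Complex.exp_eq_exp_ℂ]
    exact NormedSpace.map_exp (ev k) (continuous_eval_const k) y
  have hJ : DifferentiableOn ℂ (fun x => (1 - J x) * Ring.inverse (1 + J x)) (ball 0 1) :=
    fun x hx => (((differentiableAt_const 1).sub J.differentiableAt).mul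
      (((differentiableAt_const 1).add J.differentiableAt).inverse
        (hunit x hx))).differentiableWithinAt
  have hmain : DifferentiableOn ℂ (fun x => evalCLM ℂ 0
      (B (NormedSpace.exp (d • 1 - R ((1 - J x) * Ring.inverse (1 + J x)))))) (ball 0 1) :=
    (((evalCLM ℂ 0 : (ℕ →ᵇ ℂ) →L[ℂ] ℂ).comp B).differentiable.comp hexp).comp_differentiableOn
      ((differentiableOn_const (d • (1 : ℕ →ᵇ ℂ))).sub
        (R.differentiable.comp_differentiableOn hJ))
  refine hmain.congr fun x hx => ?_
  change _ = B _ 0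
  rw [hB]
  refine tsum_congr fun k => ?_
  rw [hev, rowExponent, BoundedContinuousFunction.sub_apply, hR]
  simp only [hcay x hx]
  simp

/-- A sequence of modulus `< 1` vanishing from some index on, as a point of the unit ball. -/
lemma exists_C0_of_eventually_zero {y : ℕ → ℂ} (hy : ∀ j, ‖y j‖ < 1) {M : ℕ}
    (h0 : ∀ j, M < j → y j = 0) : ∃ x ∈ ball (0 : C₀(ℕ, ℂ)) 1, (x : ℕ → ℂ) = y := by
  have hlim : Tendsto y (cocompact ℕ) (𝓝 0) := by
    rw [cocompact_eq_atTop]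
    exact tendsto_const_nhds.congr'
      ((eventually_gt_atTop M).mono fun j hj => (h0 j hj).symm)
  let x : C₀(ℕ, ℂ) := ⟨⟨y, continuous_of_discreteTopology⟩, hlim⟩
  obtain ⟨m, -, hm⟩ := (Finset.range (M + 1)).exists_max_image (fun j => ‖y j‖)
    ⟨0, by simp⟩
  refine ⟨x, ?_, rfl⟩
  rw [mem_ball_zero_iff]
  refine lt_of_le_of_lt ?_ (hy m)
  refine (norm_le (f := x.toBCF) (norm_nonneg (y m))).2 fun j => ?_
  change ‖y j‖ ≤ _
  by_cases hj : j < M + 1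
  · exact hm j (by simpa using hj)
  · rw [h0 j (by omega), norm_zero]
    positivity

lemma lp_one_summable (β : lp (fun _ : ℕ => ℂ) 1) : Summable fun k => ‖β k‖ := by
  simpa using (lp.memℓp β).summable (by norm_num)

lemma lp_one_norm (β : lp (fun _ : ℕ => ℂ) 1) : ‖β‖ = ∑' k, ‖β k‖ := by
  simpa using lp.norm_eq_tsum_rpow (p := 1) (by norm_num) β

/-- A summable sequence of positive weights with sum `δ`. -/
def weight (δ : ℝ) (i : ℕ) : ℂ := ((δ / 2 / 2 ^ i : ℝ) : ℂ)

lemma norm_weight {δ : ℝ} (hδ : 0 < δ) (i : ℕ) : ‖weight δ i‖ = δ / 2 / 2 ^ i := by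
  rw [weight, Complex.norm_real, Real.norm_of_nonneg (by positivity)]

lemma summable_norm_weight {δ : ℝ} (hδ : 0 < δ) : Summable fun i => ‖weight δ i‖ := by
  simp only [norm_weight hδ]
  exact (hasSum_geometric_two' δ).summable

lemma hasSum_weight (δ : ℝ) : HasSum (weight δ) (δ : ℂ) :=
  Complex.hasSum_ofReal.2 (hasSum_geometric_two' δ)

lemma weight_ne_zero {δ : ℝ} (hδ : 0 < δ) (i : ℕ) : weight δ i ≠ 0 := by
  rw [← norm_pos_iff, norm_weight hδ]
  positivity

lemma norm_exp_sub_rowExponent_le {δ : ℝ} (hδ : 0 < δ) {x : C₀(ℕ, ℂ)} (hx : x ∈ ball 0 1)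
    (k : ℕ) : ‖Complex.exp (δ - rowExponent (weight δ) k x)‖ ≤ Real.exp δ := by
  have hx' := mem_ball_zero_iff.1 hx
  have hs := summable_mul_cayley (summable_norm_weight hδ) hx' (C0_norm_apply_le x) k
  rw [Complex.norm_exp, Real.exp_le_exp, Complex.sub_re, Complex.ofReal_re, rowExponent,
    Complex.re_tsum hs]
  refine sub_le_self _ (tsum_nonneg fun i => ?_)
  rw [weight, Complex.re_ofReal_mul]
  exact mul_nonneg (by positivity) (cayley_re_nonneg ((C0_norm_apply_le x _).trans_lt hx'))

lemma summable_mul_of_norm_le {β e : ℕ → ℂ} (hβ : Summable fun k => ‖β k‖) {C : ℝ}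
    (he : ∀ k, ‖e k‖ ≤ C) : Summable fun k => β k * e k :=
  Summable.of_norm_bounded (hβ.mul_right C) fun k => by
    rw [norm_mul]
    exact mul_le_mul_of_nonneg_left (he k) (norm_nonneg _)

lemma tendsto_tsum_mul {β : ℕ → ℂ} (hβ : Summable fun k => ‖β k‖) {C : ℝ} {e : ℕ → ℕ → ℂ}
    {e' : ℕ → ℂ} (he : ∀ N k, ‖e N k‖ ≤ C)
    (hlim : ∀ k, Tendsto (fun N => e N k) atTop (𝓝 (e' k))) :
    Tendsto (fun N => ∑' k, β k * e N k) atTop (𝓝 (∑' k, β k * e' k)) := by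
  refine tendsto_tsum_of_dominated_convergence (hβ.mul_right C)
    (fun k => (hlim k).const_mul (β k)) (Eventually.of_forall fun N k => ?_)
  rw [norm_mul]
  exact mul_le_mul_of_nonneg_left (he N k) (norm_nonneg _)

/-- Points of the ball along which the weighted sum of singular inner functions tends to the
`ℓ₁`-norm of the weights. -/
lemma exists_seq_tendsto_norm {δ : ℝ} (hδ : 0 < δ) {β : ℕ → ℂ} (hβ : Summable fun k => ‖β k‖) :
    ∃ x : ℕ → C₀(ℕ, ℂ), (∀ N, x N ∈ ball 0 1) ∧
      Tendsto (fun N => ∑' k, β k * Complex.exp (δ - rowExponent (weight δ) k (x N))) atTop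
        (𝓝 ((∑' k, ‖β k‖ : ℝ) : ℂ)) := by
  have hc0 : weight δ 0 = ((δ / 2 : ℝ) : ℂ) := by simp [weight]
  let w : ℕ → ℂ := fun k => 1 + ((Complex.arg (β k) / (δ / 2) : ℝ) : ℂ) * Complex.I
  have hw : ∀ k, 0 < (w k).re := fun k => by
    simp only [w, Complex.add_re, Complex.one_re, Complex.re_ofReal_mul, Complex.I_re]
    norm_num
  let y : ℕ → ℕ → ℂ := fun N j =>
    if j < N ∧ j.unpair.2 = 0 then cayley (w j.unpair.1) else 0
  have hy : ∀ N j, ‖y N j‖ < 1 := fun N j => by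
    simp only [y]
    split_ifs
    · exact norm_cayley_lt_one (hw _)
    · simp
  choose x hx hxy using fun N => exists_C0_of_eventually_zero (hy N) (M := N)
    (fun j hj => by simp only [y]; rw [if_neg]; omega)
  refine ⟨x, hx, ?_⟩
  have hlim : ∀ k, Tendsto (fun N => Complex.exp (δ - rowExponent (weight δ) k (x N))) atTop
      (𝓝 (Complex.exp (-(Complex.arg (β k) * Complex.I)))) := fun k => by
    refine tendsto_const_nhds.congr' ((eventually_gt_atTop (Nat.pair k 0)).mono fun N hN => ?_)
    have hterm : ∀ i, weight δ i * cayley (x N (Nat.pair k i)) =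
        weight δ i + if i = 0 then weight δ 0 * (w k - 1) else 0 := fun i => by
      rw [hxy]
      simp only [y, Nat.unpair_pair]
      rcases eq_or_ne i 0 with rfl | hi
      · rw [if_pos ⟨hN, rfl⟩, cayley_cayley (hw k)]
        simp only [if_true]
        ring
      · rw [if_neg (fun h => hi h.2), cayley_zero, if_neg hi]
        ring
    have hsum : rowExponent (weight δ) k (x N) = δ + weight δ 0 * (w k - 1) := by
      rw [rowExponent, tsum_congr hterm]
      exact ((hasSum_weight δ).add (hasSum_ite_eq 0 _)).tsum_eq
    have hδ' : (δ : ℂ) ≠ 0 := by exact_mod_cast hδ.ne'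
    simp only [hsum, hc0]
    congr 1
    simp only [w]
    push_cast
    field_simp
    ring
  have h := tendsto_tsum_mul hβ (fun N k => norm_exp_sub_rowExponent_le hδ (hx N) k) hlim
  convert h using 2
  rw [Complex.ofReal_tsum]
  refine tsum_congr fun k => ?_
  conv_rhs => rw [← Complex.norm_mul_exp_arg_mul_I (β k)]
  rw [mul_assoc, Complex.norm_mul_exp_arg_mul_I, ← Complex.exp_add, add_neg_cancel,
    Complex.exp_zero, mul_one]

/-- Points of the ball converging coordinatewise to `u` along which exactly one of the row
exponents acquires an extra summand `w`, prescribed in the right half-plane. -/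
lemma exists_seq_tendsto_rowExponent {δ ρ : ℝ} (hδ : 0 < δ) (hρ1 : ρ < 1) {u : ℕ → ℂ}
    (hu : ∀ j, ‖u j‖ ≤ ρ) (m : ℕ) {w : ℂ} (hw : 0 < w.re) :
    ∃ x : ℕ → C₀(ℕ, ℂ), (∀ N, x N ∈ ball 0 1) ∧
      (∀ j, Tendsto (fun N => x N j) atTop (𝓝 (u j))) ∧
      ∀ k, Tendsto (fun N => rowExponent (weight δ) k (x N)) atTop
        (𝓝 (rowExponent (weight δ) k u + if k = m then w else 0)) := by
  have hρ : 0 ≤ ρ := (norm_nonneg _).trans (hu 0)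
  have hwN : ∀ N, 0 < (w / weight δ N).re := fun N => by
    rw [weight, Complex.div_ofReal_re]
    positivity
  let t : ℕ → ℕ → ℂ := fun N j => if j < N then u j else 0
  have ht : ∀ N j, ‖t N j‖ ≤ ρ := fun N j => by
    simp only [t]
    split_ifs
    · exact hu j
    · simpa using hρ
  let y : ℕ → ℕ → ℂ := fun N j =>
    if j = Nat.pair m N then cayley (w / weight δ N) else t N j
  have hy : ∀ N j, ‖y N j‖ < 1 := fun N j => by
    simp only [y]
    split_ifs
    · exact norm_cayley_lt_one (hwN N)
    · exact (ht N j).trans_lt hρ1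
  have hle : ∀ N, N ≤ Nat.pair m N := fun N => Nat.right_le_pair m N
  choose x hx hxy using fun N => exists_C0_of_eventually_zero (hy N) (M := Nat.pair m N)
    (fun j hj => by
      have := hle N
      simp only [y, t]
      rw [if_neg (by omega), if_neg (by omega)])
  have htlim : ∀ j, ∀ᶠ N in atTop, t N j = u j := fun j =>
    (eventually_gt_atTop j).mono fun N hN => if_pos hN
  refine ⟨x, hx, fun j => ?_, fun k => ?_⟩
  · refine tendsto_const_nhds.congr' ?_
    filter_upwards [htlim j, eventually_gt_atTop j] with N hN hjN
    have := hle N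
    rw [hxy, ← hN]
    simp only [y]
    rw [if_neg (by omega)]
  · have hbase : Tendsto (fun N => rowExponent (weight δ) k (t N)) atTop
        (𝓝 (rowExponent (weight δ) k u)) :=
      tendsto_tsum_mul (summable_norm_weight hδ)
        (fun N i => norm_cayley_le hρ1 (ht N (Nat.pair k i))) fun i =>
          tendsto_const_nhds.congr' ((htlim (Nat.pair k i)).mono fun N hN => by simp only [hN])
    have hextra : Tendsto (fun N => if k = m then w - weight δ N else 0) atTop
        (𝓝 (if k = m then w else 0)) := by
      split_ifs
      · simpa using (hasSum_weight δ).summable.tendsto_atTop_zero.const_sub w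
      · exact tendsto_const_nhds
    refine (hbase.add hextra).congr fun N => ?_
    have hterm : ∀ i, weight δ i * cayley (x N (Nat.pair k i)) =
        weight δ i * cayley (t N (Nat.pair k i)) +
          if i = N then (if k = m then w - weight δ N else 0) else 0 := fun i => by
      rw [hxy]
      simp only [y, Nat.pair_eq_pair]
      by_cases hi : i = N
      · subst hi
        by_cases hk : k = m
        · subst hk
          have h0 : t i (Nat.pair k i) = 0 := if_neg (by have := Nat.right_le_pair k i; omega)
          simp only [and_self, if_true]
          rw [cayley_cayley (hwN i), h0, cayley_zero, mul_div_cancel₀ _ (weight_ne_zero hδ i)]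
          ring
        · simp [hk]
      · simp [hi]
    rw [rowExponent, rowExponent, tsum_congr hterm]
    exact (((summable_mul_cayley (summable_norm_weight hδ) hρ1 (ht N) k).hasSum.add
      (hasSum_ite_eq N _)).tsum_eq).symm

/-- for every `0 < ρ < 1` and `ε > 0` there is a linear map
`T : ℓ₁ → H^∞(B_{c₀})` with `‖β‖₁ ≤ sup_{B_{c₀}} |T β| ≤ (1+ε)‖β‖₁` such that for every
`β ≠ 0` and every `u` in `ρ` times the closed unit ball of `ℓ_∞`, the cluster set
`Cl_{B_{c₀}}(T β, u)` contains a disk of positive radius. -/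
theorem stmt10 (ρ : ℝ) (hρ : 0 < ρ) (hρ1 : ρ < 1) (ε : ℝ) (hε : 0 < ε) :
    ∃ T : lp (fun _ : ℕ => ℂ) 1 → (C₀(ℕ, ℂ) → ℂ), IsLinearMap ℂ T ∧
      (∀ β, DifferentiableOn ℂ (T β) (ball 0 1)) ∧
      (∀ β, (∀ x ∈ ball (0 : C₀(ℕ, ℂ)) 1, ‖T β x‖ ≤ (1 + ε) * ‖β‖) ∧
        ‖β‖ ≤ ⨆ x ∈ ball (0 : C₀(ℕ, ℂ)) 1, ‖T β x‖) ∧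
      (∀ β, β ≠ 0 → ∀ u : ℕ → ℂ, (∀ j, ‖u j‖ ≤ ρ) →
        ∃ (c : ℂ) (r : ℝ), 0 < r ∧ ball c r ⊆ clusterSetC0 (T β) u) := by
  set δ := Real.log (1 + ε)
  have hδ : 0 < δ := Real.log_pos (by linarith)
  have hexpδ : Real.exp δ = 1 + ε := Real.exp_log (by linarith)
  let e : ℕ → C₀(ℕ, ℂ) → ℂ := fun k x => Complex.exp (δ - rowExponent (weight δ) k x)
  -- Off the unit ball the series need not converge, so the map is set to zero there.
  let T : lp (fun _ : ℕ => ℂ) 1 → (C₀(ℕ, ℂ) → ℂ) := fun β =>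
    (ball (0 : C₀(ℕ, ℂ)) 1).indicator fun x => ∑' k, β k * e k x
  have hT : ∀ β, ∀ x ∈ ball (0 : C₀(ℕ, ℂ)) 1, T β x = ∑' k, β k * e k x := fun β x hx =>
    Set.indicator_of_mem hx _
  have he : ∀ x ∈ ball (0 : C₀(ℕ, ℂ)) 1, ∀ k, ‖e k x‖ ≤ 1 + ε := fun x hx k =>
    (norm_exp_sub_rowExponent_le hδ hx k).trans_eq hexpδ
  have hs : ∀ β : lp (fun _ : ℕ => ℂ) 1, ∀ x ∈ ball (0 : C₀(ℕ, ℂ)) 1,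
      Summable fun k => β k * e k x := fun β x hx =>
    summable_mul_of_norm_le (lp_one_summable β) (he x hx)
  have hbound : ∀ β, ∀ x ∈ ball (0 : C₀(ℕ, ℂ)) 1, ‖T β x‖ ≤ (1 + ε) * ‖β‖ := fun β x hx => by
    rw [hT β x hx, lp_one_norm, mul_comm, ← tsum_mul_right]
    refine tsum_of_norm_bounded ((lp_one_summable β).mul_right _).hasSum fun k => ?_
    rw [norm_mul]
    exact mul_le_mul_of_nonneg_left (he x hx k) (norm_nonneg _)
  refine ⟨T, ⟨fun β γ => ?_, fun a β => ?_⟩, fun β => ?_, fun β => ⟨hbound β, ?_⟩,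
    fun β hβ u hu => ?_⟩
  · funext x
    by_cases hx : x ∈ ball (0 : C₀(ℕ, ℂ)) 1
    · rw [Pi.add_apply, hT _ x hx, hT _ x hx, hT _ x hx, ← (hs β x hx).tsum_add (hs γ x hx)]
      exact tsum_congr fun k => by simp [add_mul]
    · simp only [T, Pi.add_apply, Set.indicator_of_notMem hx, add_zero]
  · funext x
    by_cases hx : x ∈ ball (0 : C₀(ℕ, ℂ)) 1
    · rw [Pi.smul_apply, hT _ x hx, hT _ x hx, smul_eq_mul, ← tsum_mul_left]
      exact tsum_congr fun k => by simp [mul_assoc]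
    · simp only [T, Pi.smul_apply, Set.indicator_of_notMem hx, smul_zero]
  · exact (differentiableOn_tsum_mul_exp (lp_one_summable β) (summable_norm_weight hδ) δ).congr
      (hT β)
  · obtain ⟨x, hx, hlim⟩ := exists_seq_tendsto_norm hδ (lp_one_summable β)
    rw [← lp_one_norm] at hlim
    have hnorm := hlim.norm
    rw [Complex.norm_real, norm_norm] at hnorm
    refine le_of_tendsto' hnorm fun N => ?_
    have hbdd : BddAbove (Set.range fun x : C₀(ℕ, ℂ) =>
        ⨆ _ : x ∈ ball (0 : C₀(ℕ, ℂ)) 1, ‖T β x‖) := by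
      refine ⟨(1 + ε) * ‖β‖, ?_⟩
      rintro _ ⟨x, rfl⟩
      exact Real.iSup_le (hbound β x) (by positivity)
    refine le_trans ?_ (le_ciSup hbdd (x N))
    rw [ciSup_pos (hx N), hT β _ (hx N)]
  · obtain ⟨m, hm⟩ : ∃ m, β m ≠ 0 := by
      by_contra! h
      exact hβ (lp.ext (funext h))
    let E : ℕ → ℂ := fun k => Complex.exp (δ - rowExponent (weight δ) k u)
    let b : ℂ := β m * E m
    have hb : b ≠ 0 := mul_ne_zero hm (Complex.exp_ne_zero _)
    let s : ℂ := ∑' k, if k = m then 0 else β k * E k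
    refine ⟨s + b / 2, ‖b‖ / 2, by positivity, fun lam hlam => ?_⟩
    let v : ℂ := (lam - s) / b
    have hv : ‖v - 1 / 2‖ < 1 / 2 := by
      have h : v - 1 / 2 = (lam - (s + b / 2)) / b := by
        simp only [v]
        field_simp
        ring
      rw [h, norm_div, div_lt_iff₀ (norm_pos_iff.2 hb)]
      rw [mem_ball, dist_eq_norm] at hlam
      linarith
    have hv0 : v ≠ 0 := by
      rintro h
      norm_num [h] at hv
    have hv1 : ‖v‖ < 1 := by
      have h := norm_add_le (v - 1 / 2) (1 / 2)
      rw [sub_add_cancel] at h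
      norm_num at h hv ⊢
      linarith
    have hw : 0 < (-Complex.log v).re := by
      rw [Complex.neg_re, Complex.log_re]
      exact neg_pos.2 (Real.log_neg (norm_pos_iff.2 hv0) hv1)
    obtain ⟨x, hx, hxu, hxe⟩ := exists_seq_tendsto_rowExponent hδ hρ1 hu m hw
    refine ⟨ℕ, atTop, x, inferInstance, hx, fun a => ?_, ?_⟩
    · exact tendsto_tsum_mul (lp_one_summable a) (C := 1)
        (fun N j => (C0_norm_apply_le (x N) j).trans (mem_ball_zero_iff.1 (hx N)).le) hxu
    · simp only [fun N => hT β (x N) (hx N)]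
      have hlim := tendsto_tsum_mul (lp_one_summable β) (fun N k => he (x N) (hx N) k)
        fun k => ((hxe k).const_sub (δ : ℂ)).cexp
      convert hlim using 2
      have hE : Summable fun k => β k * Complex.exp (δ - (rowExponent (weight δ) k u +
          if k = m then -Complex.log v else 0)) :=
        summable_mul_of_norm_le (lp_one_summable β) fun k =>
          le_of_tendsto' ((hxe k).const_sub (δ : ℂ)).cexp.norm fun N => he (x N) (hx N) k
      rw [hE.tsum_eq_add_tsum_ite m]
      have hsm : lam = b * v + s := by
        simp only [v]
        field_simp
        ring
      rw [hsm]
      congr 1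
      · simp only [if_true, b, E]
        rw [← sub_sub, sub_neg_eq_add, Complex.exp_add, Complex.exp_log hv0, mul_assoc]
      · refine tsum_congr fun k => ?_
        split_ifs with hk
        · rfl
        · rw [add_zero]
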